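/- Let X be a path-connected topological space such that π₂(X) = 0 (the second homotopy group is trivial at every basepoint). Let z : S¹ → X be a continuous free loop, and let γ ∈ π₁(X, z(1)) denote the homotopy class of the based loop t ↦ z(exp(2πit)) at the basepoint z(1). Then the fundamental group of the free loop space C(S¹, X) (equipped with the compact-open topology) based at the point z is isomorphic as a group to the centralizer C_{π₁(X, z(1))}(γ) of γ in π₁(X, z(1)). -/

import Mathlib

open scoped Real

/-- The based loop `t ↦ z (exp (2 π i t))` at the basepoint `z 1`, associated to a
free loop `z : S¹ → X`. -/
noncomputable def baseLoopOfFreeLoop {X : Type*} [TopologicalSpace X] (z : C(Circle, X)) :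
    Path (z 1) (z 1) where
  toFun t := z (Circle.exp (2 * π * t))
  continuous_toFun := by fun_prop
  source' := by simp
  target' := by simp

attribute [local instance] Path.Homotopic.setoid

open scoped unitInterval
open Path.Homotopic (Quotient)

namespace FLS

instance contrI : ContractibleSpace I := (convex_Icc (0:ℝ) 1).contractibleSpace ⟨0, by simp⟩

variable {X Y : Type*} [TopologicalSpace X] [TopologicalSpace Y]

/-- The two ways around a square are homotopic. -/
lemma square (S : C(I × I, Y)) {y00 y10 y01 y11 : Y} (a : Path y00 y10) (b : Path y10 y11)
    (c : Path y00 y01) (d : Path y01 y11) (ha : ∀ s, a s = S (s, 0)) (hb : ∀ r, b r = S (1, r))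
    (hc : ∀ r, c r = S (0, r)) (hd : ∀ s, d s = S (s, 1)) :
    (a.trans b).Homotopic (c.trans d) := by
  obtain rfl : S (0, 0) = y00 := by rw [← ha, a.source]
  obtain rfl : S (1, 0) = y10 := by rw [← ha, a.target]
  obtain rfl : S (0, 1) = y01 := by rw [← hd, d.source]
  obtain rfl : S (1, 1) = y11 := by rw [← hd, d.target]
  let a' : Path ((0, 0) : I × I) (1, 0) := ⟨⟨fun s => (s, 0), by fun_prop⟩, rfl, rfl⟩
  let b' : Path ((1, 0) : I × I) (1, 1) := ⟨⟨fun s => (1, s), by fun_prop⟩, rfl, rfl⟩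
  let c' : Path ((0, 0) : I × I) (0, 1) := ⟨⟨fun s => (0, s), by fun_prop⟩, rfl, rfl⟩
  let d' : Path ((0, 1) : I × I) (1, 1) := ⟨⟨fun s => (s, 1), by fun_prop⟩, rfl, rfl⟩
  have h := (SimplyConnectedSpace.paths_homotopic (a'.trans b') (c'.trans d')).map S
  rw [Path.map_trans, Path.map_trans] at h
  have e1 : a = a'.map S.continuous := by ext s; exact ha s
  have e2 : b = b'.map S.continuous := by ext s; exact hb s
  have e3 : c = c'.map S.continuous := by ext s; exact hc s
  have e4 : d = d'.map S.continuous := by ext s; exact hd s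
  rw [e1, e2, e3, e4]
  exact h

lemma cancel {y y' : Y} (P : Path y y) (β : Path y y') (P' : Path y' y')
    (h : (P.trans β).Homotopic (β.trans P')) (h' : P'.Homotopic (Path.refl y')) :
    P.Homotopic (Path.refl y) := by
  rw [← Path.Homotopic.Quotient.eq] at h h' ⊢
  rw [Quotient.mk_trans, Quotient.mk_trans, h', Quotient.mk_refl, Quotient.trans_refl] at h
  have := congrArg (fun q => Quotient.trans q (Quotient.symm (Path.Homotopic.Quotient.mk β))) h
  simpa using this

lemma transfer (S : C(I × I, Y)) {y y' : Y} (P : Path y y) (P' : Path y' y')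
    (h0 : ∀ s, S (s, 0) = P s) (h1 : ∀ s, S (s, 1) = P' s) (hS : ∀ r, S (0, r) = S (1, r))
    (hnull : P'.Homotopic (Path.refl y')) : P.Homotopic (Path.refl y) := by
  let β : Path y y' := ⟨⟨fun r => S (0, r), by fun_prop⟩, by simp [h0], by simp [h1]⟩
  exact cancel P β P' (square S P β β P' (fun s => (h0 s).symm) hS (fun _ => rfl)
    (fun s => (h1 s).symm)) hnull

/-- The path from `0` to `1` in the interval. -/
def idp : Path (0 : I) 1 := ⟨⟨fun s => s, by fun_prop⟩, rfl, rfl⟩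

lemma idp_map {x y : X} (γ : Path x y) : (idp.map γ.continuous) = γ.cast γ.source γ.target := by
  ext; rfl

/-- a homotopy in path space from a homotopy -/
def pathOfHomotopy {x y : X} {p q : Path x y} (H : p.Homotopy q) : Path p q where
  toFun r := H.eval r
  continuous_toFun := by
    rw [← Path.continuous_uncurry_iff]
    exact H.continuous
  source' := H.eval_zero
  target' := H.eval_one

lemma loopNull_refl {x : X} (h : Subsingleton (HomotopyGroup (Fin 2) X x))
    (P : Path (Path.refl x) (Path.refl x)) : P.Homotopic (Path.refl _) := by
  have hc : Continuous (fun y : I × I => P y.1 y.2) :=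
    Path.continuous_uncurry_iff.2 P.continuous
  let f : GenLoop (Fin 2) X x := ⟨⟨fun y => P (y 0) (y 1), 
    hc.comp (by fun_prop : Continuous fun y : Fin 2 → I => (y 0, y 1))⟩, by
    rintro y ⟨i, hi⟩
    show P (y 0) (y 1) = x
    fin_cases i
    · rcases hi with hi | hi
      · simp at hi; simp [hi]
      · simp at hi; simp [hi]
    · rcases hi with hi | hi
      · simp at hi; simp [hi]
      · simp at hi; simp [hi]⟩
  have hf : GenLoop.Homotopic f GenLoop.const :=
    _root_.Quotient.exact (s := GenLoop.Homotopic.setoid (Fin 2) x)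
      (h.elim (Quotient.mk _ f) (Quotient.mk _ GenLoop.const))
  obtain ⟨H⟩ := hf
  have hb (r s t : I) (h : s = 0 ∨ s = 1 ∨ t = 0 ∨ t = 1) : H (r, ![s, t]) = x := by
    have : (![s, t] : Fin 2 → I) ∈ Cube.boundary (Fin 2) := by
      rcases h with h | h | h | h
      · exact ⟨0, by simp [h]⟩
      · exact ⟨0, by simp [h]⟩
      · exact ⟨1, by simp [h]⟩
      · exact ⟨1, by simp [h]⟩
    rw [H.eq_fst r this]
    exact f.2 _ this
  let G : I × I → Path x x := fun p => ⟨⟨fun t => H (p.1, ![p.2, t]), by fun_prop⟩,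
    hb _ _ _ (by simp), hb _ _ _ (by simp)⟩
  have hG : Continuous G := by
    rw [← Path.continuous_uncurry_iff]
    show Continuous fun p : (I × I) × I => H (p.1.1, ![p.1.2, p.2])
    fun_prop
  refine ⟨⟨⟨⟨G, hG⟩, ?_, ?_⟩, ?_⟩⟩
  · intro s
    ext t
    show H (0, ![s, t]) = P s t
    rw [H.apply_zero]; rfl
  · intro s
    ext t
    show H (1, ![s, t]) = x
    rw [H.apply_one]; rfl
  · intro r s hs
    ext t
    show H (r, ![s, t]) = P s t
    rw [hb]
    · rcases hs with hs | hs
      · simp [hs]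
      · simp at hs; simp [hs]
    · simp at hs; tauto

lemma trans_congr {x y z x' y' z' : X} {p : Path x y} {q : Path y z} {p' : Path x' y'}
    {q' : Path y' z'} (hp : ∀ t, p t = p' t) (hq : ∀ t, q t = q' t) (t : I) :
    (p.trans q) t = (p'.trans q') t := by
  simp only [Path.trans_apply, hp, hq]

lemma apply_trans {x y z : Y} {x' y' z' : X} {p : Path x y} {q : Path y z} {p' : Path x' y'}
    {q' : Path y' z'} (f : Y → X) (hp : ∀ t, f (p t) = p' t) (hq : ∀ t, f (q t) = q' t) (t : I) :
    f ((p.trans q) t) = (p'.trans q') t := by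
  simp only [Path.trans_apply]
  split_ifs
  · exact hp _
  · exact hq _

lemma conj_null {y y' : Y} (P : Path y y) (β : Path y y')
    (h : ∀ P' : Path y' y', P'.Homotopic (Path.refl y')) : P.Homotopic (Path.refl y) := by
  refine cancel P β (β.symm.trans (P.trans β)) ?_ (h _)
  rw [← Path.Homotopic.Quotient.eq]
  simp [← Quotient.trans_assoc]

lemma loopNull {x : X} (h : Subsingleton (HomotopyGroup (Fin 2) X x)) (w : Path x x)
    (P : Path w w) : P.Homotopic (Path.refl _) := by
  have hPc : Continuous (fun y : I × I => P y.1 y.2) :=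
    Path.continuous_uncurry_iff.2 P.continuous
  -- the tail of `w`
  let wr : ∀ r : I, Path (w (σ r)) x := fun r =>
    ⟨⟨fun t => w (σ (r * σ t)), by fun_prop⟩, by simp, by simp⟩
  have hwr : Continuous ↿wr := by
    show Continuous fun p : I × I => w (σ (p.1 * σ p.2))
    fun_prop
  have hwr0 : ∀ t, wr 0 t = x := fun t => by simp [wr]
  have hwr1 : ∀ t, wr 1 t = w t := fun t => by simp [wr]
  let G : I × I → Path x x := fun p => ((P p.1).trans (wr p.2).symm).trans (wr p.2)
  have hG : Continuous G := by
    rw [← Path.continuous_uncurry_iff]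
    have h1 : Continuous ↿(fun p : I × I => P p.1) :=
      hPc.comp (by fun_prop : Continuous fun p : (I × I) × I => (p.1.1, p.2))
    have h2 : Continuous ↿(fun p : I × I => wr p.2) :=
      hwr.comp (by fun_prop : Continuous fun p : (I × I) × I => (p.1.2, p.2))
    exact Path.trans_continuous_family _
      (Path.trans_continuous_family _ h1 _ (Path.symm_continuous_family _ h2)) _ h2
  have hG1 : ∀ s, G (s, 1) = ((P s).trans w.symm).trans w := by
    intro s
    ext t
    exact trans_congr (trans_congr (fun _ => rfl) (fun t => hwr1 (σ t))) hwr1 t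
  have hG0 : ∀ s, G (s, 0) = ((P s).trans (Path.refl x)).trans (Path.refl x) := by
    intro s
    ext t
    exact trans_congr (trans_congr (fun _ => rfl) (fun t => hwr0 (σ t))) hwr0 t
  let m0 : C(Path x x, Path x x) := ⟨fun q => (q.trans (Path.refl x)).trans (Path.refl x),
    by fun_prop⟩
  let m1 : C(Path x x, Path x x) := ⟨fun q => q.trans w.symm, by fun_prop⟩
  let m2 : C(Path x x, Path x x) := ⟨fun q => q.trans w, by fun_prop⟩
  have hQ : (P.map m1.continuous).Homotopic (Path.refl _) := by
    obtain ⟨K⟩ := Path.Homotopic.trans_symm w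
    exact conj_null _ (pathOfHomotopy K) (loopNull_refl h)
  have hQ2 : ((P.map m1.continuous).map m2.continuous).Homotopic (Path.refl _) := hQ.map m2
  have hQ0 : (P.map m0.continuous).Homotopic (Path.refl _) := by
    refine transfer ⟨G, hG⟩ _ _ (fun s => hG0 s) (fun s => hG1 s) ?_ hQ2
    intro r
    simp [G]
  obtain ⟨ρ⟩ := SimplyConnectedSpace.paths_homotopic idp
    ((idp.trans (Path.refl 1)).trans (Path.refl 1))
  let R : I × I → Path x x := fun p => ⟨⟨fun t => P p.1 (ρ (p.2, t)),
    hPc.comp (by fun_prop : Continuous fun t => (p.1, ρ (p.2, t)))⟩, by simp, by simp⟩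
  have hR : Continuous R := by
    rw [← Path.continuous_uncurry_iff]
    exact hPc.comp (by fun_prop : Continuous fun p : (I × I) × I => (p.1.1, ρ (p.1.2, p.2)))
  refine transfer ⟨R, hR⟩ _ _ ?_ ?_ ?_ hQ0
  · intro s
    ext t
    show P s (ρ (0, t)) = _
    rw [ρ.apply_zero]; rfl
  · intro s
    ext t
    show P s (ρ (1, t)) = _
    rw [ρ.apply_one]
    exact apply_trans (P s) (apply_trans (P s) (fun _ => rfl) (fun _ => (P s).target))
      (fun _ => (P s).target) t
  · intro r
    simp [R]

/-! ### The circle -/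

/-- The parametrization of the circle by the interval. -/
noncomputable def ee : C(I, Circle) := ⟨fun t => Circle.exp (2 * π * t), by fun_prop⟩

lemma ee_zero : ee 0 = 1 := by simp [ee]
lemma ee_one : ee 1 = 1 := by simp [ee]

lemma ee_eq {t t' : I} (h : ee t = ee t') : t = t' ∨ (t = 0 ∧ t' = 1) ∨ (t = 1 ∧ t' = 0) := by
  obtain ⟨m, hm⟩ := Circle.exp_eq_exp.1 h
  have hm' : (t : ℝ) = t' + m := by
    have := Real.pi_pos
    have h2 : (2 * π) * (t : ℝ) = (2 * π) * (t' + m) := by rw [hm]; ring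
    exact mul_left_cancel₀ (by positivity) h2
  have h0 := t.2.1
  have h1 := t.2.2
  have h0' := t'.2.1
  have h1' := t'.2.2
  have hlt : m < 2 := by
    have : (m : ℝ) < 2 := by linarith
    exact_mod_cast this
  have hgt : -2 < m := by
    have : (-2 : ℝ) < m := by linarith
    exact_mod_cast this
  have : m = -1 ∨ m = 0 ∨ m = 1 := by omega
  rcases this with rfl | rfl | rfl
  · right; left
    push_cast at hm'
    constructor <;> apply Subtype.ext <;> simp only [Set.Icc.coe_zero, Set.Icc.coe_one] <;> linarith
  · left
    push_cast at hm'
    apply Subtype.ext; linarith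
  · right; right
    push_cast at hm'
    constructor <;> apply Subtype.ext <;> simp only [Set.Icc.coe_zero, Set.Icc.coe_one] <;> linarith

lemma ee_surj : Function.Surjective ee := by
  intro c
  obtain ⟨θ, rfl⟩ : ∃ θ, Circle.exp θ = c := ⟨_, Circle.exp_arg c⟩
  have h2 : (0:ℝ) < 2 * π := by have := Real.pi_pos; positivity
  refine ⟨⟨Int.fract (θ / (2 * π)), Int.fract_nonneg _, (Int.fract_lt_one _).le⟩, ?_⟩
  apply Circle.exp_eq_exp.2
  refine ⟨-⌊θ / (2 * π)⌋, ?_⟩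
  simp only [Int.fract]
  push_cast
  field_simp
  ring

lemma ext_ee {w w' : C(Circle, X)} (h : ∀ t, w (ee t) = w' (ee t)) : w = w' := by
  ext c
  obtain ⟨t, rfl⟩ := ee_surj c
  exact h t

lemma quot {S : Type*} [TopologicalSpace S] :
    Topology.IsQuotientMap ((ContinuousMap.id S).prodMap ee) := by
  have h : IsProperMap (Prod.map (id : S → S) ee) :=
    isProperMap_id.prodMap ee.continuous.isProperMap
  exact h.isClosedMap.isQuotientMap h.continuous (Function.surjective_id.prodMap ee_surj)

lemma exists_lift {S : Type*} [TopologicalSpace S] (Φ : S × I → X) (hΦ : Continuous Φ)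
    (h : ∀ s, Φ (s, 0) = Φ (s, 1)) : ∃ L : C(S, C(Circle, X)), ∀ s t, L s (ee t) = Φ (s, t) := by
  have hf : Function.FactorsThrough (⟨Φ, hΦ⟩ : C(S × I, X)) ((ContinuousMap.id S).prodMap ee) := by
    rintro ⟨s, t⟩ ⟨s', t'⟩ hst
    obtain ⟨h1, h2⟩ := Prod.ext_iff.1 hst
    change s = s' at h1
    change ee t = ee t' at h2
    subst h1
    rcases ee_eq h2 with h3 | ⟨h3, h4⟩ | ⟨h3, h4⟩
    · simp [h3]
    · simp [h3, h4, h]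
    · simp [h3, h4, h]
  refine ⟨(quot.lift _ hf).curry, fun s t => ?_⟩
  exact congrArg (fun g : C(S × I, X) => g (s, t)) (quot.lift_comp (⟨Φ, hΦ⟩ : C(S × I, X)) hf)

/-- Evaluation at `1`. -/
noncomputable def ev : C(C(Circle, X), X) := ⟨fun w => w 1, by fun_prop⟩

lemma exists_reparam {S : Type*} [TopologicalSpace S] (Z : C(S, C(Circle, X))) :
    ∃ R : C(S × I, C(Circle, X)), (∀ s, R (s, 0) = Z s) ∧
      (∀ s r, R (s, r) 1 = Z s 1) ∧
      (∀ s (w : Path (Z s 1) (Z s 1)), (∀ t, w t = Z s (ee t)) → ∀ t,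
        R (s, 1) (ee t) = (((Path.refl (Z s 1)).symm.trans w).trans (Path.refl _)) t) ∧
      (∀ s s', Z s = Z s' → ∀ r, R (s, r) = R (s', r)) := by
  obtain ⟨ρ⟩ := SimplyConnectedSpace.paths_homotopic idp
    (((Path.refl 0).symm.trans idp).trans (Path.refl 1))
  obtain ⟨R, hR⟩ := exists_lift (S := S × I) (fun p => Z p.1.1 (ee (ρ (p.1.2, p.2))))
    (by fun_prop) (by
      intro p
      have h0 := ρ.source p.2
      have h1 := ρ.target p.2
      simp only [h0, h1, ee_zero, ee_one])
  refine ⟨R, ?_, ?_, ?_, ?_⟩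
  · intro s
    apply ext_ee
    intro t
    rw [hR]
    show Z s (ee (ρ (0, t))) = _
    rw [ρ.apply_zero]; rfl
  · intro s r
    rw [← ee_zero, hR]
    have h0 := ρ.source r
    simp only [h0]
  · intro s w hw t
    rw [hR]
    show Z s (ee (ρ (1, t))) = _
    rw [ρ.apply_one]
    refine apply_trans (fun t => Z s (ee t)) (apply_trans (fun t => Z s (ee t)) (fun t => ?_)
      (fun t => (hw t).symm)) (fun t => ?_) t
    · simp [ee_zero]
    · simp [ee_one]
  · intro s s' h r
    apply ext_ee
    intro t
    rw [hR, hR]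
    simp [h]

/-- Conjugating a family of loops by a family of paths, as a family of free loops. -/
lemma exists_conj {S : Type*} [TopologicalSpace S] {a b : S → X} (F : ∀ s, Path (a s) (a s))
    (hF : Continuous ↿F) (k : ∀ s, Path (a s) (b s)) (hk : Continuous ↿k) :
    ∃ L : C(S, C(Circle, X)), ∀ s t, L s (ee t) = (((k s).symm.trans (F s)).trans (k s)) t := by
  refine exists_lift (fun p : S × I => (((k p.1).symm.trans (F p.1)).trans (k p.1)) p.2) ?_ ?_
  · exact Path.trans_continuous_family _
      (Path.trans_continuous_family _ (Path.symm_continuous_family _ hk) _ hF) _ hk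
  · intro s
    simp

lemma exists_incl (x : X) : ∃ j : C(Path x x, C(Circle, X)), ∀ w t, j w (ee t) = w t :=
  exists_lift (fun p : Path x x × I => p.1 p.2) (Path.continuous_uncurry_iff.2 continuous_id)
    (by simp)

lemma inj (hπ₂ : ∀ x : X, Subsingleton (HomotopyGroup (Fin 2) X x)) {z : C(Circle, X)}
    (P : Path z z) (hP : (P.map (ev (X := X)).continuous).Homotopic (Path.refl _)) :
    P.Homotopic (Path.refl z) := by
  obtain ⟨K⟩ := hP
  have hK0 : ∀ s, K (0, s) = P s 1 := fun s => K.apply_zero s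
  have hK1 : ∀ s, K (1, s) = z 1 := fun s => K.apply_one s
  have hKs : ∀ r, K (r, 0) = z 1 := fun r => K.source r
  have hKt : ∀ r, K (r, 1) = z 1 := fun r => K.target r
  let F : ∀ s : I, Path (P s 1) (P s 1) := fun s => ⟨⟨fun t => P s (ee t), by fun_prop⟩,
    by simp [ee_zero], by simp [ee_one]⟩
  have hF : Continuous ↿F := by
    show Continuous fun p : I × I => P p.1 (ee p.2)
    fun_prop
  let k : ∀ p : I × I, Path (P p.1 1) (K (p.2, p.1)) := fun p =>
    ⟨⟨fun t => K (p.2 * t, p.1), by fun_prop⟩, by simp [hK0], by simp⟩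
  have hk : Continuous ↿k := by
    show Continuous fun p : (I × I) × I => K (p.1.2 * p.2, p.1.1)
    fun_prop
  obtain ⟨L, hL⟩ := exists_conj (S := I × I) (fun p => F p.1)
    (hF.comp (by fun_prop : Continuous fun p : (I × I) × I => (p.1.1, p.2))) k hk
  obtain ⟨R, hR0, -, hR1, hRe⟩ := exists_reparam P.toContinuousMap
  obtain ⟨j, hj⟩ := exists_incl (z 1)
  -- the final loop
  let k1 : ∀ s : I, Path (P s 1) (z 1) := fun s => (k (s, 1)).cast rfl (hK1 s).symm
  have hk1 : Continuous ↿k1 := hk.comp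
    (by fun_prop : Continuous fun p : I × I => (((p.1, 1) : I × I), p.2))
  let Q : I → Path (z 1) (z 1) := fun s => ((k1 s).symm.trans (F s)).trans (k1 s)
  have hQ : Continuous Q := by
    rw [← Path.continuous_uncurry_iff]
    exact Path.trans_continuous_family _
      (Path.trans_continuous_family _ (Path.symm_continuous_family _ hk1) _ hF) _ hk1
  have hF01 : ∀ t, F 0 t = F 1 t := fun t => by simp [F]
  have hk01 : ∀ r t, k (0, r) t = k (1, r) t := fun r t => by
    show K (r * t, 0) = K (r * t, 1)
    rw [hKs, hKt]
  have hQ01 : Q 0 = Q 1 := by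
    ext t
    exact trans_congr (trans_congr (fun t => hk01 1 (σ t)) hF01) (hk01 1) t
  let QP : Path (Q 0) (Q 0) := ⟨⟨Q, hQ⟩, rfl, hQ01.symm⟩
  have hQP := (loopNull (hπ₂ _) _ QP).map j
  have hL01 : ∀ r, L (0, r) = L (1, r) := by
    intro r
    apply ext_ee
    intro t
    rw [hL, hL]
    exact trans_congr (trans_congr (fun t => hk01 r (σ t)) hF01) (hk01 r) t
  let L0 : Path (L (0, 0)) (L (0, 0)) := ⟨⟨fun s => L (s, 0), by fun_prop⟩, rfl, (hL01 0).symm⟩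
  have hL0 : L0.Homotopic (Path.refl _) := by
    refine transfer L L0 (QP.map j.continuous) (fun _ => rfl) ?_ hL01 hQP
    intro s
    apply ext_ee
    intro t
    rw [hL]
    refine Eq.trans ?_ (hj (Q s) t).symm
    exact trans_congr (trans_congr (fun _ => rfl) (fun _ => rfl)) (fun _ => rfl) t
  refine transfer R P L0 hR0 ?_ (fun r => hRe 0 1 (by simp) r) hL0
  intro s
  apply ext_ee
  intro t
  rw [hR1 s (F s) (fun _ => rfl)]
  refine Eq.trans ?_ (hL (s, 0) t).symm
  have hk0 : ∀ t, k (s, 0) t = P s 1 := fun t => by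
    show K (0 * t, s) = _
    rw [zero_mul, hK0]
  exact trans_congr (trans_congr (fun t => (hk0 (σ t)).symm) (fun _ => rfl))
    (fun t => (hk0 t).symm) t

lemma range_le {z : C(Circle, X)} (P : Path z z) :
    ((P.map (ev (X := X)).continuous).trans (baseLoopOfFreeLoop z)).Homotopic
      ((baseLoopOfFreeLoop z).trans (P.map (ev (X := X)).continuous)) := by
  refine square ⟨fun p => P p.1 (ee p.2), by fun_prop⟩ _ _ _ _ ?_ ?_ ?_ ?_
  · intro s; simp only [ContinuousMap.coe_mk, ee_zero]; rfl
  · intro r; simp only [ContinuousMap.coe_mk, Path.source, Path.target]; rfl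
  · intro r; simp only [ContinuousMap.coe_mk, Path.source, Path.target]; rfl
  · intro s; simp only [ContinuousMap.coe_mk, ee_one]; rfl

lemma surj (z : C(Circle, X)) (c : Path (z 1) (z 1))
    (h : (c.trans (baseLoopOfFreeLoop z)).Homotopic ((baseLoopOfFreeLoop z).trans c)) :
    ∃ P : Path z z, (P.map (ev (X := X)).continuous).Homotopic c := by
  let w := baseLoopOfFreeLoop z
  have hw : ∀ t, w t = z (ee t) := fun _ => rfl
  obtain ⟨R, hR0, hRe, hR1, -⟩ := exists_reparam (ContinuousMap.const Unit z)
  let k : ∀ r : I, Path (z 1) (c r) := fun r =>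
    ⟨⟨fun t => c (r * t), by fun_prop⟩, by simp, by simp⟩
  have hk : Continuous ↿k := by
    show Continuous fun p : I × I => c (p.1 * p.2)
    fun_prop
  obtain ⟨L, hL⟩ := exists_conj (S := I) (fun _ => w)
    (by show Continuous fun p : I × I => w p.2; fun_prop) k hk
  obtain ⟨j, hj⟩ := exists_incl (z 1)
  have hL0 : L 0 = R ((), 1) := by
    apply ext_ee
    intro t
    rw [hL]
    refine Eq.trans ?_ (hR1 () w hw t).symm
    have hk0 : ∀ t, k 0 t = z 1 := fun t => by
      show c (0 * t) = _
      simp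
    exact trans_congr (trans_congr (fun t => hk0 (σ t)) (fun _ => rfl)) hk0 t
  have hL1 : L 1 = j ((c.symm.trans w).trans c) := by
    apply ext_ee
    intro t
    rw [hL, hj]
    have hk0 : ∀ t, k 1 t = c t := fun t => by
      show c (1 * t) = _
      simp
    exact trans_congr (trans_congr (fun t => hk0 (σ t)) (fun _ => rfl)) hk0 t
  have hjw : j w = z := ext_ee fun t => hj w t
  have hH : ((c.symm.trans w).trans c).Homotopic w := by
    rw [← Path.Homotopic.Quotient.eq] at h ⊢
    simp only [Quotient.mk_trans, Quotient.mk_symm, Quotient.trans_assoc] at h ⊢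
    rw [← h, ← Quotient.trans_assoc]
    simp [w]
  obtain ⟨H⟩ := hH
  let P1 : Path z (L 0) := ⟨⟨fun r => R ((), r), by fun_prop⟩, hR0 (), hL0.symm⟩
  let P2 : Path (L 0) (L 1) := ⟨L, rfl, rfl⟩
  let P3 : Path (L 1) z := ((pathOfHomotopy H).map j.continuous).cast hL1 hjw.symm
  refine ⟨(P1.trans P2).trans P3, ?_⟩
  rw [Path.map_trans, Path.map_trans]
  have key : ((P1.map (ev (X := X)).continuous).trans (P2.map (ev (X := X)).continuous)).trans
      (P3.map (ev (X := X)).continuous) = ((Path.refl (z 1)).trans c).trans (Path.refl (z 1)) := by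
    ext t
    refine trans_congr (trans_congr (fun t => ?_) (fun t => ?_)) (fun t => ?_) t
    · exact hRe () t
    · show L t 1 = c t
      refine ((congrArg (L t) ee_zero).symm.trans (hL t 0)).trans ?_
      simp
    · show j _ 1 = z 1
      refine ((congrArg (j _) ee_zero).symm.trans (hj _ 0)).trans ?_
      simp
  rw [key]
  exact (Path.Homotopic.trans_refl _).trans (Path.Homotopic.refl_trans _)

end FLS


/-- Let `X` be a path-connected space with vanishing second homotopy groups, let
`z : S¹ → X` be a free loop and `γ ∈ π₁(X, z 1)` the class of the based loop
`t ↦ z (exp (2 π i t))`.  Then the fundamental group of the free loop space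
`C(S¹, X)` based at `z` is isomorphic to the centralizer of `γ` in `π₁(X, z 1)`. -/
theorem stmt4 {X : Type*} [TopologicalSpace X] [PathConnectedSpace X]
    (hπ₂ : ∀ x : X, Subsingleton (HomotopyGroup (Fin 2) X x))
    (z : C(Circle, X)) :
    Nonempty (FundamentalGroup C(Circle, X) z ≃*
      Subgroup.centralizer
        ({FundamentalGroup.fromPath (X := TopCat.of X) ⟦baseLoopOfFreeLoop z⟧} :
          Set (FundamentalGroup X (z 1)))) := by
  let ψ : FundamentalGroup C(Circle, X) z →* FundamentalGroup X (z 1) :=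
    FundamentalGroup.map (FLS.ev (X := X)) z
  have hinj : Function.Injective ψ := by
    rw [injective_iff_map_eq_one]
    intro p hp
    induction p using Path.Homotopic.Quotient.ind with | mk P =>
    apply Quotient.sound
    exact FLS.inj hπ₂ P (Quotient.exact hp)
  have hrange : ψ.range = Subgroup.centralizer
        ({FundamentalGroup.fromPath (X := TopCat.of X) ⟦baseLoopOfFreeLoop z⟧} :
          Set (FundamentalGroup X (z 1))) := by
    ext c
    rw [Subgroup.mem_centralizer_singleton_iff]
    constructor
    · rintro ⟨p, rfl⟩
      induction p using Path.Homotopic.Quotient.ind with | mk P =>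
      exact (Quotient.sound (FLS.range_le P)).symm
    · intro h
      induction c using Path.Homotopic.Quotient.ind with | mk c =>
      obtain ⟨P, hP⟩ := FLS.surj z c (Path.Homotopic.symm (Quotient.exact h))
      exact ⟨Path.Homotopic.Quotient.mk P, Quotient.sound hP⟩
  exact ⟨(MonoidHom.ofInjective hinj).trans (MulEquiv.subgroupCongr hrange)⟩
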